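/- arXiv:2207.00201 — 3 statements merged into one kernel-verified Lean document; each statement's English description precedes it below -/
import Mathlib

section
/- Let 0 < H < 1 and define R(s,t) = (t + s)^{2H} − |t − s|^{2H}. Then for any n ≥ 1 and any strictly increasing times 0 < t₁ < t₂ < ⋯ < t_n, the n×n matrix V with entries V_{ij} = R(t_i, t_j) is strictly positive definite. -/
open Matrix Real
open MeasureTheory Set

/-- Sines of distinct positive frequencies are linearly independent: they are eigenvectors, with
distinct eigenvalues, of `f ↦ f (· + h) + f (· - h)` for small `h`. -/
theorem linearIndependent_sin_mul {n : ℕ} {t : Fin n → ℝ} (hpos : ∀ i, 0 < t i)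
    (ht : Function.Injective t) :
    LinearIndependent ℝ fun i (x : ℝ) => sin (t i * x) := by
  set h : ℝ := (1 + ∑ j, t j)⁻¹ with hh
  have hS : 0 < 1 + ∑ j, t j := by
    have := Finset.sum_nonneg fun j (_ : j ∈ Finset.univ) => (hpos j).le
    linarith
  have hh0 : 0 < h := inv_pos.2 hS
  have hmem (i) : t i * h ∈ Icc 0 π := by
    refine ⟨(mul_pos (hpos i) hh0).le, ?_⟩
    have h1 := Finset.single_le_sum (fun j _ => (hpos j).le) (Finset.mem_univ i)
    have h2 : t i * h ≤ 1 := by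
      rw [hh, ← div_eq_mul_inv, div_le_one hS]
      linarith
    linarith [pi_gt_three]
  let T : Module.End ℝ (ℝ → ℝ) :=
    LinearMap.funLeft ℝ ℝ (fun x => x + h) + LinearMap.funLeft ℝ ℝ (fun x => x - h)
  refine Module.End.eigenvectors_linearIndependent' T (fun i => 2 * cos (t i * h)) ?_ _ fun i => ?_
  · intro i j hij
    have := injOn_cos (hmem i) (hmem j) (mul_left_cancel₀ two_ne_zero hij)
    exact ht (mul_right_cancel₀ hh0.ne' this)
  · refine Module.End.hasEigenvector_iff.2 ⟨Module.End.mem_eigenspace_iff.2 ?_, fun h0 => ?_⟩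
    · ext x
      simp only [T, LinearMap.add_apply, Pi.add_apply, LinearMap.funLeft_apply, Pi.smul_apply,
        smul_eq_mul, mul_add, mul_sub, sin_add, sin_sub]
      ring
    · have := congrFun h0 (π / 2 / t i)
      simp [mul_div_cancel₀ _ (hpos i).ne'] at this

theorem integrableOn_one_sub_cos_mul_rpow {a : ℝ} (ha0 : 0 < a) (ha2 : a < 2) :
    IntegrableOn (fun u : ℝ => (1 - cos u) * u ^ (-1 - a)) (Ioi 0) := by
  have hm : Measurable fun u : ℝ => (1 - cos u) * u ^ (-1 - a) := by fun_prop
  rw [← Ioc_union_Ioi_eq_Ioi zero_le_one]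
  refine IntegrableOn.union ?_ ?_
  · have hi : IntegrableOn (fun u : ℝ => u ^ (1 - a)) (Ioc 0 1) :=
      (intervalIntegrable_iff_integrableOn_Ioc_of_le zero_le_one).1
        (intervalIntegral.intervalIntegrable_rpow' (by linarith))
    refine Integrable.mono' hi hm.aestronglyMeasurable
      ((ae_restrict_iff' measurableSet_Ioc).2 (.of_forall fun u hu => ?_))
    have h1 := one_sub_sq_div_two_le_cos (x := u)
    rw [norm_of_nonneg (mul_nonneg (sub_nonneg.2 (cos_le_one u)) (rpow_nonneg hu.1.le _)),
      show (1 - a : ℝ) = 2 + (-1 - a) by ring, rpow_add hu.1, rpow_two]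
    exact mul_le_mul_of_nonneg_right (by nlinarith [sq_nonneg u]) (rpow_nonneg hu.1.le _)
  · have hi : IntegrableOn (fun u : ℝ => 2 * u ^ (-1 - a)) (Ioi 1) :=
      (integrableOn_Ioi_rpow_of_lt (by linarith) one_pos).const_mul 2
    refine Integrable.mono' hi hm.aestronglyMeasurable
      ((ae_restrict_iff' measurableSet_Ioi).2 (.of_forall fun u hu => ?_))
    have hu0 : (0 : ℝ) ≤ u := zero_le_one.trans (mem_Ioi.1 hu).le
    rw [norm_of_nonneg (mul_nonneg (sub_nonneg.2 (cos_le_one u)) (rpow_nonneg hu0 _))]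
    exact mul_le_mul_of_nonneg_right (by linarith [neg_one_le_cos u]) (rpow_nonneg hu0 _)

theorem one_sub_cos_mul_rpow_eq {a x u : ℝ} (hx : 0 < x) (hu : 0 < u) :
    (1 - cos (x * u)) * u ^ (-1 - a) =
      x ^ (1 + a) * ((1 - cos (x * u)) * (x * u) ^ (-1 - a)) := by
  rw [mul_rpow hx.le hu.le, show (-1 - a : ℝ) = -(1 + a) by ring, rpow_neg hx.le]
  field_simp [(rpow_pos_of_pos hx (1 + a)).ne']

theorem integrableOn_one_sub_cos_mul_mul_rpow {a : ℝ} (ha0 : 0 < a) (ha2 : a < 2) (x : ℝ) :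
    IntegrableOn (fun u : ℝ => (1 - cos (x * u)) * u ^ (-1 - a)) (Ioi 0) := by
  wlog hx : 0 ≤ x generalizing x
  · simpa using this (-x) (by linarith)
  obtain rfl | hx := hx.eq_or_lt
  · simp
  have h := (integrableOn_Ioi_comp_mul_left_iff (fun u : ℝ => (1 - cos u) * u ^ (-1 - a)) 0 hx).2
    (by simpa using integrableOn_one_sub_cos_mul_rpow ha0 ha2)
  exact IntegrableOn.congr_fun (h.const_mul (x ^ (1 + a)))
    (fun u hu => (one_sub_cos_mul_rpow_eq hx hu).symm) measurableSet_Ioi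

/-- The integral representation of `|x| ^ a`, up to a constant factor. -/
theorem integral_one_sub_cos_mul_mul_rpow {a : ℝ} (ha0 : 0 < a) (x : ℝ) :
    ∫ u in Ioi (0 : ℝ), (1 - cos (x * u)) * u ^ (-1 - a) =
      |x| ^ a * ∫ u in Ioi (0 : ℝ), (1 - cos u) * u ^ (-1 - a) := by
  wlog hx : 0 ≤ x generalizing x
  · simpa using this (-x) (by linarith)
  obtain rfl | hx := hx.eq_or_lt
  · simp [zero_rpow ha0.ne']
  rw [setIntegral_congr_fun measurableSet_Ioi fun u hu => one_sub_cos_mul_rpow_eq hx hu,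
    integral_const_mul, integral_comp_mul_left_Ioi (fun u : ℝ => (1 - cos u) * u ^ (-1 - a)) 0 hx,
    mul_zero, smul_eq_mul, ← mul_assoc, abs_of_pos hx, add_comm, rpow_add_one hx.ne',
    mul_inv_cancel_right₀ hx.ne']

theorem integral_one_sub_cos_mul_rpow_pos {a : ℝ} (ha0 : 0 < a) (ha2 : a < 2) :
    0 < ∫ u in Ioi (0 : ℝ), (1 - cos u) * u ^ (-1 - a) := by
  rw [setIntegral_pos_iff_support_of_nonneg_ae
    ((ae_restrict_iff' measurableSet_Ioi).2 (.of_forall fun u hu =>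
      mul_nonneg (sub_nonneg.2 (cos_le_one u)) (rpow_nonneg (mem_Ioi.1 hu).le _)))
    (integrableOn_one_sub_cos_mul_rpow ha0 ha2)]
  refine lt_of_lt_of_le ?_ (measure_mono (s := Ioo 0 π) fun u hu => ⟨?_, hu.1⟩)
  · simp [pi_pos]
  · have : cos u < 1 := by
      simpa using cos_lt_cos_of_nonneg_of_le_pi le_rfl hu.2.le hu.1
    exact mul_ne_zero (sub_pos.2 this).ne' (rpow_pos_of_pos hu.1 _).ne'

theorem sin_mul_sin_mul_rpow_eq (a x y u : ℝ) :
    sin (x * u) * sin (y * u) * u ^ (-1 - a) =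
      ((1 - cos ((x + y) * u)) * u ^ (-1 - a) - (1 - cos ((y - x) * u)) * u ^ (-1 - a)) / 2 := by
  rw [add_mul x, sub_mul y, cos_add, cos_sub]
  ring

theorem integrableOn_sin_mul_sin_mul_rpow {a : ℝ} (ha0 : 0 < a) (ha2 : a < 2) (x y : ℝ) :
    IntegrableOn (fun u : ℝ => sin (x * u) * sin (y * u) * u ^ (-1 - a)) (Ioi 0) := by
  simp_rw [sin_mul_sin_mul_rpow_eq]
  exact ((integrableOn_one_sub_cos_mul_mul_rpow ha0 ha2 _).sub
    (integrableOn_one_sub_cos_mul_mul_rpow ha0 ha2 _)).div_const 2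

theorem integral_sin_mul_sin_mul_rpow {a : ℝ} (ha0 : 0 < a) (ha2 : a < 2) (x y : ℝ) :
    ∫ u in Ioi (0 : ℝ), sin (x * u) * sin (y * u) * u ^ (-1 - a) =
      (|x + y| ^ a - |y - x| ^ a) * ((∫ u in Ioi (0 : ℝ), (1 - cos u) * u ^ (-1 - a)) / 2) := by
  simp_rw [sin_mul_sin_mul_rpow_eq]
  rw [integral_div, integral_sub (integrableOn_one_sub_cos_mul_mul_rpow ha0 ha2 _)
    (integrableOn_one_sub_cos_mul_mul_rpow ha0 ha2 _), integral_one_sub_cos_mul_mul_rpow ha0,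
    integral_one_sub_cos_mul_mul_rpow ha0]
  ring

theorem sum_mul_sin_sq_mul_eq {n : ℕ} (t v : Fin n → ℝ) (u w : ℝ) :
    (∑ i, v i * sin (t i * u)) ^ 2 * w =
      ∑ i, ∑ j, v i * v j * (sin (t i * u) * sin (t j * u) * w) := by
  rw [sq, Finset.sum_mul_sum, Finset.sum_mul]
  refine Finset.sum_congr rfl fun i _ => ?_
  rw [Finset.sum_mul]
  exact Finset.sum_congr rfl fun j _ => by ring

theorem integral_sum_mul_sin_sq_mul_rpow_pos {a : ℝ} (ha0 : 0 < a) (ha2 : a < 2) {n : ℕ}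
    {t v : Fin n → ℝ} (hpos : ∀ i, 0 < t i) (ht : Function.Injective t) (hv : v ≠ 0) :
    0 < ∫ u in Ioi (0 : ℝ), (∑ i, v i * sin (t i * u)) ^ 2 * u ^ (-1 - a) := by
  set f : ℝ → ℝ := fun u => ∑ i, v i * sin (t i * u) with hf
  have hnn : 0 ≤ᵐ[volume.restrict (Ioi (0 : ℝ))] fun u => f u ^ 2 * u ^ (-1 - a) :=
    (ae_restrict_iff' measurableSet_Ioi).2 (.of_forall fun u hu =>
      mul_nonneg (sq_nonneg _) (rpow_nonneg (mem_Ioi.1 hu).le _))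
  have hint : IntegrableOn (fun u => f u ^ 2 * u ^ (-1 - a)) (Ioi 0) := by
    simp_rw [hf, sum_mul_sin_sq_mul_eq]
    exact integrable_finsetSum _ fun i _ => integrable_finsetSum _ fun j _ =>
      (integrableOn_sin_mul_sin_mul_rpow ha0 ha2 _ _).const_mul _
  refine (integral_nonneg_of_ae hnn).lt_of_ne' fun h0 => hv ?_
  have hae : f =ᵐ[volume.restrict (Ioi (0 : ℝ))] 0 := by
    filter_upwards [(integral_eq_zero_iff_of_nonneg_ae hnn hint).1 h0,
      ae_restrict_mem measurableSet_Ioi] with u hu hu0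
    simpa [(rpow_pos_of_pos hu0 (-1 - a)).ne'] using hu
  have heq : EqOn f 0 (Ioi 0) := Measure.eqOn_open_of_ae_eq hae isOpen_Ioi
    (by fun_prop) continuousOn_const
  have hzero : ∑ i, v i • (fun x : ℝ => sin (t i * x)) = 0 := by
    ext x
    have hodd : f (-x) = -f x := by simp [hf]
    have hx : f x = 0 := by
      rcases lt_trichotomy x 0 with h | rfl | h
      · have := heq (show -x ∈ Ioi (0 : ℝ) by simpa using h)
        simpa [hodd] using this
      · simp [hf]
      · exact heq h
    simpa [hf] using hx
  exact funext (Fintype.linearIndependent_iff.1 (linearIndependent_sin_mul hpos ht) v hzero)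

theorem twosided_fbm_covariance_matrix_posDef (H : ℝ) (hH0 : 0 < H) (hH1 : H < 1)
    (n : ℕ) (hn : 1 ≤ n) (t : Fin n → ℝ)
    (hpos : ∀ i, 0 < t i) (hmono : StrictMono t) :
    (Matrix.of fun i j : Fin n =>
      (t i + t j) ^ (2 * H) - |t j - t i| ^ (2 * H)).PosDef := by
  have ha0 : 0 < 2 * H := by linarith
  have ha2 : 2 * H < 2 := by linarith
  refine Matrix.PosDef.of_dotProduct_mulVec_pos ?_ fun v hv => ?_
  · ext i j
    simp [add_comm, abs_sub_comm]
  · have hC := half_pos (integral_one_sub_cos_mul_rpow_pos ha0 ha2)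
    have hI := integral_sum_mul_sin_sq_mul_rpow_pos ha0 ha2 hpos hmono.injective hv
    refine pos_of_mul_pos_left (hI.trans_eq ?_) hC.le
    simp_rw [sum_mul_sin_sq_mul_eq]
    rw [integral_finsetSum _ fun i _ => integrable_finsetSum _ fun j _ =>
      (integrableOn_sin_mul_sin_mul_rpow ha0 ha2 _ _).const_mul _]
    simp only [dotProduct, mulVec, Finset.mul_sum, Finset.sum_mul]
    refine Finset.sum_congr rfl fun i _ => ?_
    rw [integral_finsetSum _ fun j _ =>
      (integrableOn_sin_mul_sin_mul_rpow ha0 ha2 _ _).const_mul _]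
    refine Finset.sum_congr rfl fun j _ => ?_
    rw [integral_const_mul, integral_sin_mul_sin_mul_rpow ha0 ha2,
      abs_of_pos (add_pos (hpos i) (hpos j))]
    simp only [Pi.star_apply, star_trivial, of_apply]
    ring
end

section
/- Let 0 < H < 1/2 and K ∈ (0,1), and define R(t,s) = ½[t^{2H} + s^{2H} − K(t + s)^{2H} − (1 − K)|t − s|^{2H}]. Then for any n ≥ 1 and any strictly increasing times 0 < t₁ < t₂ < ⋯ < t_n, the n×n matrix V with entries V_{ij} = R(t_i, t_j) is strictly positive definite. -/
open Matrix Real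

open MeasureTheory Set in
theorem setIntegral_pos_of_continuousOn_of_nonneg {f : ℝ → ℝ} {s : Set ℝ} (hs : IsOpen s)
    (hf : ContinuousOn f s) (hfi : IntegrableOn f s) (hnonneg : ∀ x ∈ s, 0 ≤ f x)
    (hne : ∃ x ∈ s, f x ≠ 0) : 0 < ∫ x in s, f x := by
  have hae : 0 ≤ᵐ[volume.restrict s] f :=
    (ae_restrict_iff' hs.measurableSet).2 (Filter.Eventually.of_forall hnonneg)
  refine (integral_nonneg_of_ae hae).lt_of_ne' fun h ↦ ?_
  obtain ⟨x, hx, hfx⟩ := hne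
  exact hfx (Measure.eqOn_open_of_ae_eq
    ((setIntegral_eq_zero_iff_of_nonneg_ae hae hfi).1 h) hs hf continuousOn_const hx)

section ExpRepresentation

open MeasureTheory Set

variable {α : ℝ}

theorem continuousOn_one_sub_exp_neg_mul_rpow (α x : ℝ) :
    ContinuousOn (fun u : ℝ ↦ (1 - exp (-(x * u))) * u ^ (-1 - α)) (Ioi 0) :=
  ContinuousOn.mul (by fun_prop)
    (continuousOn_id.rpow_const fun u hu ↦ Or.inl (ne_of_gt hu))

theorem integrableOn_one_sub_exp_neg_mul_rpow (h0 : 0 < α) (h1 : α < 1) :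
    IntegrableOn (fun u : ℝ ↦ (1 - exp (-u)) * u ^ (-1 - α)) (Ioi 0) := by
  have hcont : ContinuousOn (fun u : ℝ ↦ (1 - exp (-u)) * u ^ (-1 - α)) (Ioi 0) := by
    simpa using continuousOn_one_sub_exp_neg_mul_rpow α 1
  rw [← Ioc_union_Ioi_eq_Ioi zero_le_one, integrableOn_union]
  constructor
  · have hint : IntegrableOn (fun u : ℝ ↦ u ^ (-α)) (Ioc 0 1) :=
      (integrableOn_Ioc_iff_integrableOn_Ioo).2
        ((intervalIntegral.integrableOn_Ioo_rpow_iff one_pos).2 (by linarith))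
    refine hint.mono' ((hcont.mono fun u hu ↦ hu.1).aestronglyMeasurable measurableSet_Ioc)
      ((ae_restrict_iff' measurableSet_Ioc).2 (Filter.Eventually.of_forall fun u hu ↦ ?_))
    have hu0 : 0 < u := hu.1
    have hle : 1 - exp (-u) ≤ u := by linarith [add_one_le_exp (-u)]
    have hnn : 0 ≤ 1 - exp (-u) := by simp [hu0.le]
    rw [norm_of_nonneg (mul_nonneg hnn (by positivity))]
    calc (1 - exp (-u)) * u ^ (-1 - α) ≤ u * u ^ (-1 - α) := by gcongr
      _ = u ^ (-α) := by
        rw [← rpow_one_add' hu0.le (by linarith)]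
        ring_nf
  · refine (integrableOn_Ioi_rpow_of_lt (a := -1 - α) (by linarith) one_pos).mono'
      ((hcont.mono (Ioi_subset_Ioi zero_le_one)).aestronglyMeasurable measurableSet_Ioi)
      ((ae_restrict_iff' measurableSet_Ioi).2 (Filter.Eventually.of_forall fun u hu ↦ ?_))
    have hu0 : 0 < u := one_pos.trans hu
    have hnn : 0 ≤ 1 - exp (-u) := by simp [hu0.le]
    rw [norm_of_nonneg (mul_nonneg hnn (by positivity))]
    exact mul_le_of_le_one_left (by positivity) (by linarith [exp_pos (-u)])

theorem integral_one_sub_exp_neg_mul_rpow_pos (h0 : 0 < α) (h1 : α < 1) :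
    0 < ∫ u in Ioi (0 : ℝ), (1 - exp (-u)) * u ^ (-1 - α) := by
  refine setIntegral_pos_of_continuousOn_of_nonneg isOpen_Ioi
    (by simpa using continuousOn_one_sub_exp_neg_mul_rpow α 1)
    (integrableOn_one_sub_exp_neg_mul_rpow h0 h1) (fun u hu ↦ ?_) ⟨1, mem_Ioi.2 one_pos, ?_⟩
  · have hu0 : 0 < u := hu
    exact mul_nonneg (by simp [hu0.le]) (by positivity)
  · have : exp (-1) < 1 := by simp
    simpa using (sub_pos.2 this).ne'

theorem one_sub_exp_neg_mul_rpow_scale {x u : ℝ} (hx : 0 < x) (hu : 0 < u) :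
    (1 - exp (-(x * u))) * u ^ (-1 - α) =
      x ^ (1 + α) * ((1 - exp (-(x * u))) * (x * u) ^ (-1 - α)) := by
  rw [mul_rpow hx.le hu.le, show -1 - α = -(1 + α) by ring, rpow_neg hx.le]
  have : x ^ (1 + α) ≠ 0 := (rpow_pos_of_pos hx _).ne'
  field_simp

theorem integrableOn_one_sub_exp_neg_mul_mul_rpow (h0 : 0 < α) (h1 : α < 1) {x : ℝ}
    (hx : 0 ≤ x) :
    IntegrableOn (fun u : ℝ ↦ (1 - exp (-(x * u))) * u ^ (-1 - α)) (Ioi 0) := by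
  rcases hx.eq_or_lt with rfl | hx
  · simp
  rw [integrableOn_congr_fun (fun u (hu : u ∈ Ioi 0) ↦ one_sub_exp_neg_mul_rpow_scale hx hu)
    measurableSet_Ioi]
  refine Integrable.const_mul ?_ _
  refine (integrableOn_Ioi_comp_mul_left_iff
    (fun u : ℝ ↦ (1 - exp (-u)) * u ^ (-1 - α)) 0 hx).2 ?_
  simpa using integrableOn_one_sub_exp_neg_mul_rpow h0 h1

theorem integral_one_sub_exp_neg_mul_mul_rpow (h0 : 0 < α) {x : ℝ} (hx : 0 ≤ x) :
    ∫ u in Ioi (0 : ℝ), (1 - exp (-(x * u))) * u ^ (-1 - α) =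
      x ^ α * ∫ u in Ioi (0 : ℝ), (1 - exp (-u)) * u ^ (-1 - α) := by
  rcases hx.eq_or_lt with rfl | hx
  · simp [zero_rpow h0.ne']
  rw [setIntegral_congr_fun measurableSet_Ioi
    (fun u hu ↦ one_sub_exp_neg_mul_rpow_scale hx hu), integral_const_mul,
    integral_comp_mul_left_Ioi (fun u : ℝ ↦ (1 - exp (-u)) * u ^ (-1 - α)) 0 hx, mul_zero,
    smul_eq_mul, ← mul_assoc, rpow_add hx, rpow_one]
  field_simp

end ExpRepresentation

section Kernels

variable {ι : Type*} [Fintype ι]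

theorem sum_mul_mul_min_nonneg {x : ι → ℝ} (hx : ∀ i, 0 ≤ x i) (a : ι → ℝ) :
    0 ≤ ∑ i, ∑ j, a i * a j * min (x i) (x j) := by
  have h := (MeasureTheory.posSemidef_matrix_measure_inter (μ := MeasureTheory.volume)
    (s := fun i ↦ Set.Icc 0 (x i)) (fun _ ↦ measurableSet_Icc)
    (fun _ ↦ isCompact_Icc.measure_ne_top)).dotProduct_mulVec_nonneg a
  simpa [dotProduct, mulVec, Finset.mul_sum, Set.Icc_inter_Icc, hx, mul_comm, mul_left_comm,
    mul_assoc] using h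

theorem sum_mul_mul_exp_sub_exp_nonneg {t : ι → ℝ} (ht : ∀ i, 0 ≤ t i) {u : ℝ} (hu : 0 ≤ u)
    (a : ι → ℝ) :
    0 ≤ ∑ i, ∑ j, a i * a j * (exp (-(|t i - t j| * u)) - exp (-((t i + t j) * u))) := by
  have h := sum_mul_mul_min_nonneg (x := fun i ↦ exp (2 * t i * u) - 1)
    (fun i ↦ by have := ht i; simp only [sub_nonneg, one_le_exp_iff]; positivity)
    (fun i ↦ a i * exp (-(t i * u)))
  refine h.trans_eq (Finset.sum_congr rfl fun i _ ↦ Finset.sum_congr rfl fun j _ ↦ ?_)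
  rcases le_total (t i) (t j) with hij | hij
  · have hle : exp (2 * t i * u) - 1 ≤ exp (2 * t j * u) - 1 := by gcongr
    rw [min_eq_left hle, abs_of_nonpos (sub_nonpos.2 hij),
      show -(-(t i - t j) * u) = -(t i * u) + -(t j * u) + 2 * t i * u by ring,
      show -((t i + t j) * u) = -(t i * u) + -(t j * u) by ring]
    simp only [exp_add]
    ring
  · have hle : exp (2 * t j * u) - 1 ≤ exp (2 * t i * u) - 1 := by gcongr
    rw [min_eq_right hle, abs_of_nonneg (sub_nonneg.2 hij),
      show -((t i - t j) * u) = -(t i * u) + -(t j * u) + 2 * t j * u by ring,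
      show -((t i + t j) * u) = -(t i * u) + -(t j * u) by ring]
    simp only [exp_add]
    ring

theorem sum_mul_mul_covariance_integrand (K : ℝ) (t a : ι → ℝ) (u : ℝ) :
    ∑ i, ∑ j, a i * a j * ((1 - exp (-(t i * u))) + (1 - exp (-(t j * u)))
        - K * (1 - exp (-((t i + t j) * u))) - (1 - K) * (1 - exp (-(|t i - t j| * u)))) =
      (∑ i, a i * (1 - exp (-(t i * u)))) ^ 2 + (1 - K) *
        ∑ i, ∑ j, a i * a j * (exp (-(|t i - t j| * u)) - exp (-((t i + t j) * u))) := by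
  rw [sq, Finset.sum_mul_sum, Finset.mul_sum, ← Finset.sum_add_distrib]
  refine Finset.sum_congr rfl fun i _ ↦ ?_
  rw [Finset.mul_sum, ← Finset.sum_add_distrib]
  refine Finset.sum_congr rfl fun j _ ↦ ?_
  rw [show -((t i + t j) * u) = -(t i * u) + -(t j * u) by ring, exp_add]
  ring

end Kernels

theorem exists_sum_mul_one_sub_exp_ne_zero {n : ℕ} {t : Fin n → ℝ} (ht : ∀ i, 0 < t i)
    (hinj : Function.Injective t) {a : Fin n → ℝ} (ha : a ≠ 0) :
    ∃ u : ℝ, 0 < u ∧ ∑ i, a i * (1 - exp (-(t i * u))) ≠ 0 := by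
  by_contra! h
  have hnodes : Function.Injective
      (Fin.cons 1 fun i ↦ exp (-t i) : Fin (n + 1) → ℝ) := by
    rw [Fin.cons_injective_iff]
    refine ⟨?_, fun i j hij ↦ hinj (by simpa using hij)⟩
    rintro ⟨i, hi⟩
    simp [(ht i).ne'] at hi
  have hzero := eq_zero_of_forall_pow_sum_mul_pow_eq_zero hnodes
    (v := Fin.cons (∑ i, a i) fun i ↦ -a i) fun k ↦ by
      rcases Nat.eq_zero_or_pos (k : ℕ) with hk | hk
      · simp [Fin.sum_univ_succ, hk]
      · have hsum := h k (by exact_mod_cast hk)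
        simp only [mul_sub, Finset.sum_sub_distrib, mul_one] at hsum
        simp only [Fin.sum_univ_succ, Fin.cons_zero, Fin.cons_succ, one_pow, mul_one, neg_mul,
          Finset.sum_neg_distrib, ← exp_nat_mul]
        rw [← sub_eq_add_neg, ← hsum]
        simp only [mul_neg, mul_comm]
  refine ha (funext fun i ↦ ?_)
  simpa using congrFun hzero i.succ

open MeasureTheory Set in
theorem sum_mul_mul_covariance_pos {α K : ℝ} (h0 : 0 < α) (h1 : α < 1) (hK : K ≤ 1)
    {n : ℕ} {t : Fin n → ℝ} (ht : ∀ i, 0 < t i) (hinj : Function.Injective t)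
    {a : Fin n → ℝ} (ha : a ≠ 0) :
    0 < ∑ i, ∑ j, a i * a j * (t i ^ α + t j ^ α - K * (t i + t j) ^ α
      - (1 - K) * |t i - t j| ^ α) := by
  set ψ : ℝ → ℝ → ℝ := fun x u ↦ (1 - exp (-(x * u))) * u ^ (-1 - α) with hψ
  set c : ℝ := ∫ u in Ioi (0 : ℝ), (1 - exp (-u)) * u ^ (-1 - α)
  have hψi {x : ℝ} (hx : 0 ≤ x) : Integrable (ψ x) (volume.restrict (Ioi 0)) :=
    integrableOn_one_sub_exp_neg_mul_mul_rpow h0 h1 hx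
  have hψc (x : ℝ) : ContinuousOn (ψ x) (Ioi 0) := continuousOn_one_sub_exp_neg_mul_rpow α x
  have hadd (i j) : 0 ≤ t i + t j := (add_pos (ht i) (ht j)).le
  set G : Fin n → Fin n → ℝ → ℝ := fun i j u ↦
    a i * a j * (ψ (t i) u + ψ (t j) u - K * ψ (t i + t j) u - (1 - K) * ψ |t i - t j| u)
  have hGi (i j) : Integrable (G i j) (volume.restrict (Ioi 0)) :=
    ((((hψi (ht i).le).add (hψi (ht j).le)).sub ((hψi (hadd i j)).const_mul K)).sub
      ((hψi (abs_nonneg _)).const_mul (1 - K))).const_mul _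
  have hGint (i j) : ∫ u in Ioi (0 : ℝ), G i j u =
      a i * a j * (t i ^ α + t j ^ α - K * (t i + t j) ^ α - (1 - K) * |t i - t j| ^ α) * c := by
    have e {x : ℝ} (hx : 0 ≤ x) : ∫ u in Ioi (0 : ℝ), ψ x u = x ^ α * c :=
      integral_one_sub_exp_neg_mul_mul_rpow h0 hx
    have i1 : IntegrableOn (fun u ↦ ψ (t i) u + ψ (t j) u) (Ioi 0) :=
      (hψi (ht i).le).add (hψi (ht j).le)
    have i2 := (hψi (hadd i j)).const_mul K
    have i3 := (hψi (abs_nonneg (t i - t j))).const_mul (1 - K)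
    have i12 : IntegrableOn (fun u ↦ ψ (t i) u + ψ (t j) u - K * ψ (t i + t j) u) (Ioi 0) :=
      i1.sub i2
    rw [integral_const_mul, integral_sub i12 i3, integral_sub i1 i2,
      integral_add (hψi (ht i).le) (hψi (ht j).le), integral_const_mul, integral_const_mul,
      e (ht i).le, e (ht j).le, e (hadd i j), e (abs_nonneg _)]
    ring
  have hGsum (u : ℝ) : ∑ i, ∑ j, G i j u = ((∑ i, a i * (1 - exp (-(t i * u)))) ^ 2 + (1 - K) *
      ∑ i, ∑ j, a i * a j * (exp (-(|t i - t j| * u)) - exp (-((t i + t j) * u)))) *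
        u ^ (-1 - α) := by
    rw [← sum_mul_mul_covariance_integrand, Finset.sum_mul]
    refine Finset.sum_congr rfl fun i _ ↦ ?_
    rw [Finset.sum_mul]
    refine Finset.sum_congr rfl fun j _ ↦ ?_
    simp only [G, hψ]
    ring
  have hrest {u : ℝ} (hu : 0 < u) := mul_nonneg (sub_nonneg.2 hK)
    (sum_mul_mul_exp_sub_exp_nonneg (fun i ↦ (ht i).le) hu.le a)
  have hpos : 0 < ∫ u in Ioi (0 : ℝ), ∑ i, ∑ j, G i j u := by
    refine setIntegral_pos_of_continuousOn_of_nonneg isOpen_Ioi ?_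
      (integrable_finsetSum _ fun i _ ↦ integrable_finsetSum _ fun j _ ↦ hGi i j)
      (fun u hu ↦ ?_) ?_
    · have := hψc
      simp only [G]
      fun_prop
    · have hu0 : 0 < u := hu
      rw [hGsum]
      exact mul_nonneg (add_nonneg (sq_nonneg _) (hrest hu0)) (by positivity)
    · obtain ⟨u, hu, hne⟩ := exists_sum_mul_one_sub_exp_ne_zero ht hinj ha
      refine ⟨u, hu, ?_⟩
      rw [hGsum]
      have := hrest hu
      positivity
  rw [integral_finsetSum _ fun i _ ↦ integrable_finsetSum _ fun j _ ↦ hGi i j] at hpos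
  simp_rw [integral_finsetSum _ fun j _ ↦ hGi _ j, hGint, ← Finset.sum_mul] at hpos
  exact pos_of_mul_pos_left hpos (integral_one_sub_exp_neg_mul_rpow_pos h0 h1).le

theorem MHK_covariance_matrix_posDef (H K : ℝ) (hH0 : 0 < H) (hH1 : H < 1 / 2)
    (hK0 : 0 < K) (hK1 : K < 1)
    (n : ℕ) (hn : 1 ≤ n) (t : Fin n → ℝ)
    (hpos : ∀ i, 0 < t i) (hmono : StrictMono t) :
    (Matrix.of fun i j : Fin n =>
      (1 / 2) * ((t i) ^ (2 * H) + (t j) ^ (2 * H)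
        - K * (t i + t j) ^ (2 * H) - (1 - K) * |t i - t j| ^ (2 * H))).PosDef := by
  refine PosDef.of_dotProduct_mulVec_pos (IsHermitian.ext fun i j ↦ ?_) fun a ha ↦ ?_
  · simp only [of_apply, star_trivial, abs_sub_comm (t j), add_comm (t j)]
    ring
  · have h := sum_mul_mul_covariance_pos (α := 2 * H) (by linarith) (by linarith) hK1.le hpos
      hmono.injective ha
    refine (half_pos h).trans_eq ?_
    simp only [dotProduct, mulVec, of_apply, star_trivial, Finset.mul_sum, Finset.sum_div]
    refine Finset.sum_congr rfl fun i _ ↦ Finset.sum_congr rfl fun j _ ↦ ?_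
    ring
end

section
/- Let 0 < H < 1 and K ∈ (0,1) ∪ (1,2) with HK ∈ (0,1), and define R(t,s) = 2^{−K}((s^{2H} + t^{2H})^K − |t − s|^{2HK}) (the covariance of bifractional Brownian motion with parameters H, K). Then for any n ≥ 1 and any strictly increasing times 0 < t₁ < t₂ < ⋯ < t_n, the n×n matrix V with entries V_{ij} = R(t_i, t_j) is strictly positive definite. -/
open Matrix Real

open MeasureTheory Set Filter Topology

/-- The integral over `(0, ∞)` of a continuous nonnegative function that is somewhere positive is
positive. -/
lemma setIntegral_Ioi_pos_of_continuousOn {f : ℝ → ℝ} (hc : ContinuousOn f (Ioi 0))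
    (hi : IntegrableOn f (Ioi 0)) (hnn : ∀ u, 0 < u → 0 ≤ f u) {v : ℝ} (hv : 0 < v)
    (hfv : 0 < f v) : 0 < ∫ u in Ioi (0 : ℝ), f u := by
  have hae : 0 ≤ᵐ[volume.restrict (Ioi (0 : ℝ))] f :=
    (ae_restrict_mem measurableSet_Ioi).mono fun u hu => hnn u hu
  rw [setIntegral_pos_iff_support_of_nonneg_ae hae hi]
  have hopen : IsOpen (Ioi (0 : ℝ) ∩ f ⁻¹' Ioi 0) := hc.isOpen_inter_preimage isOpen_Ioi isOpen_Ioi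
  refine (hopen.measure_pos volume ⟨v, hv, hfv⟩).trans_le (measure_mono ?_)
  exact fun u hu => ⟨ne_of_gt hu.2, hu.1⟩

/-- Integral representation of the power `x ↦ x ^ α` by dilations of a function `φ` which is
`O(u ^ p)` and `O(u ^ q)` with `q < α < p`. -/
lemma exists_integral_dilation_eq_mul_rpow {φ : ℝ → ℝ} {α p q : ℝ} (hα : 0 < α) (hqα : q < α)
    (hαp : α < p) (hc : Continuous φ) (h0 : φ 0 = 0) (h1 : 0 < φ 1)
    (hnn : ∀ u, 0 < u → 0 ≤ φ u) (hp : ∀ u, 0 < u → φ u ≤ 2 * u ^ p)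
    (hq : ∀ u, 0 < u → φ u ≤ 2 * u ^ q) :
    ∃ C : ℝ, 0 < C ∧ ∀ x : ℝ, 0 ≤ x →
      IntegrableOn (fun u => φ (x * u) * u ^ (-1 - α)) (Ioi 0) ∧
      ∫ u in Ioi (0 : ℝ), φ (x * u) * u ^ (-1 - α) = C * x ^ α := by
  have hcont : ContinuousOn (fun u : ℝ => φ u * u ^ (-1 - α)) (Ioi 0) :=
    hc.continuousOn.mul fun u hu =>
      (continuousAt_rpow_const u _ (Or.inl (ne_of_gt hu))).continuousWithinAt
  have hbound : ∀ r : ℝ, (∀ u, 0 < u → φ u ≤ 2 * u ^ r) → ∀ u : ℝ, 0 < u →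
      ‖φ u * u ^ (-1 - α)‖ ≤ 2 * u ^ (r - 1 - α) := by
    intro r hr u hu
    have hpow : 0 < u ^ (-1 - α) := rpow_pos_of_pos hu _
    rw [norm_of_nonneg (mul_nonneg (hnn u hu) hpow.le)]
    calc φ u * u ^ (-1 - α) ≤ 2 * u ^ r * u ^ (-1 - α) :=
          mul_le_mul_of_nonneg_right (hr u hu) hpow.le
      _ = 2 * u ^ (r - 1 - α) := by
          rw [mul_assoc, ← rpow_add hu]; ring_nf
  have hi : IntegrableOn (fun u : ℝ => φ u * u ^ (-1 - α)) (Ioi 0) := by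
    rw [← Ioc_union_Ioi_eq_Ioi (zero_le_one (α := ℝ)), integrableOn_union]
    constructor
    · have hg : IntegrableOn (fun u : ℝ => 2 * u ^ (p - 1 - α)) (Ioc 0 1) := by
        rw [integrableOn_Ioc_iff_integrableOn_Ioo]
        exact ((intervalIntegral.integrableOn_Ioo_rpow_iff zero_lt_one).2
          (by linarith)).const_mul 2
      refine hg.mono' ((hcont.mono Ioc_subset_Ioi_self).aestronglyMeasurable measurableSet_Ioc) ?_
      exact (ae_restrict_mem measurableSet_Ioc).mono fun u hu => hbound p hp u hu.1
    · have hg : IntegrableOn (fun u : ℝ => 2 * u ^ (q - 1 - α)) (Ioi 1) :=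
        (integrableOn_Ioi_rpow_of_lt (by linarith) zero_lt_one).const_mul 2
      refine hg.mono' ((hcont.mono (Ioi_subset_Ioi zero_le_one)).aestronglyMeasurable
        measurableSet_Ioi) ?_
      exact (ae_restrict_mem measurableSet_Ioi).mono fun u hu =>
        hbound q hq u (zero_lt_one.trans hu)
  refine ⟨∫ u in Ioi (0 : ℝ), φ u * u ^ (-1 - α), ?_, fun x hx => ?_⟩
  · refine setIntegral_Ioi_pos_of_continuousOn hcont hi
      (fun u hu => mul_nonneg (hnn u hu) (rpow_nonneg hu.le _)) zero_lt_one ?_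
    simpa using h1
  · rcases hx.eq_or_lt with rfl | hx
    · simp [h0, zero_rpow hα.ne']
    have hscale : ∀ u ∈ Ioi (0 : ℝ), x ^ (1 + α) * (φ (x * u) * (x * u) ^ (-1 - α)) =
        φ (x * u) * u ^ (-1 - α) := by
      intro u hu
      rw [mul_rpow hx.le (le_of_lt hu)]
      have : x ^ (1 + α) * x ^ (-1 - α) = 1 := by
        rw [← rpow_add hx]; ring_nf; exact rpow_zero x
      linear_combination φ (x * u) * u ^ (-1 - α) * this
    constructor
    · refine IntegrableOn.congr_fun ?_ hscale measurableSet_Ioi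
      refine Integrable.const_mul ?_ _
      exact (integrableOn_Ioi_comp_mul_left_iff (fun u => φ u * u ^ (-1 - α)) 0 hx).2
        (by simpa using hi)
    · rw [← setIntegral_congr_fun measurableSet_Ioi hscale, integral_const_mul,
        integral_comp_mul_left_Ioi (fun u => φ u * u ^ (-1 - α)) 0 hx, mul_zero, smul_eq_mul,
        rpow_add hx, rpow_one]
      field_simp

lemma exists_integral_one_sub_cos_eq_mul_rpow {α : ℝ} (h0 : 0 < α) (h2 : α < 2) :
    ∃ C : ℝ, 0 < C ∧ ∀ x : ℝ, 0 ≤ x →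
      IntegrableOn (fun u => (1 - cos (x * u)) * u ^ (-1 - α)) (Ioi 0) ∧
      ∫ u in Ioi (0 : ℝ), (1 - cos (x * u)) * u ^ (-1 - α) = C * x ^ α := by
  refine exists_integral_dilation_eq_mul_rpow (φ := fun u => 1 - cos u) h0 h0 h2 (by fun_prop)
    (by simp) ?_ (fun u _ => sub_nonneg.2 (cos_le_one u)) (fun u _ => ?_) (fun u _ => ?_)
  · have := cos_one_le
    norm_num at this ⊢
    linarith
  · have := one_sub_sq_div_two_le_cos (x := u)
    rw [rpow_two]
    nlinarith [sq_nonneg u]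
  · have := neg_one_le_cos u
    rw [rpow_zero]
    linarith

lemma exists_integral_one_sub_exp_eq_mul_rpow {α : ℝ} (h0 : 0 < α) (h1 : α < 1) :
    ∃ C : ℝ, 0 < C ∧ ∀ x : ℝ, 0 ≤ x →
      IntegrableOn (fun u => (1 - exp (-(x * u))) * u ^ (-1 - α)) (Ioi 0) ∧
      ∫ u in Ioi (0 : ℝ), (1 - exp (-(x * u))) * u ^ (-1 - α) = C * x ^ α := by
  refine exists_integral_dilation_eq_mul_rpow (φ := fun u => 1 - exp (-u)) h0 h0 h1 (by fun_prop)
    (by simp) ?_ (fun u hu => ?_) (fun u hu => ?_) (fun u _ => ?_)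
  · simp
  · simpa using hu.le
  · have := add_one_le_exp (-u)
    rw [rpow_one]
    linarith
  · have := exp_pos (-u)
    rw [rpow_zero]
    linarith

lemma exists_integral_exp_sub_one_add_eq_mul_rpow {α : ℝ} (h1 : 1 < α) (h2 : α < 2) :
    ∃ C : ℝ, 0 < C ∧ ∀ x : ℝ, 0 ≤ x →
      IntegrableOn (fun u => (exp (-(x * u)) - 1 + x * u) * u ^ (-1 - α)) (Ioi 0) ∧
      ∫ u in Ioi (0 : ℝ), (exp (-(x * u)) - 1 + x * u) * u ^ (-1 - α) = C * x ^ α := by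
  have hle : ∀ u : ℝ, 0 < u → exp (-u) - 1 + u ≤ u := by
    intro u hu
    have : exp (-u) ≤ 1 := by simpa using hu.le
    linarith
  refine exists_integral_dilation_eq_mul_rpow (φ := fun u => exp (-u) - 1 + u)
    (zero_lt_one.trans h1) h1 h2 (by fun_prop) (by simp) ?_ (fun u _ => ?_) (fun u hu => ?_)
    (fun u hu => ?_)
  · simp [exp_pos]
  · have := add_one_le_exp (-u)
    linarith
  · rw [rpow_two]
    rcases le_total u 1 with h | h
    · have := abs_exp_sub_one_sub_id_le (x := -u) (by rwa [abs_neg, abs_of_pos hu])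
      have := le_abs_self (exp (-u) - 1 - -u)
      nlinarith [sq_nonneg u]
    · nlinarith [hle u hu]
  · rw [rpow_one]
    linarith [hle u hu]

lemma Matrix.star_dotProduct_mulVec_eq_sum {n : ℕ} (A : Matrix (Fin n) (Fin n) ℝ)
    (a : Fin n → ℝ) : star a ⬝ᵥ (A *ᵥ a) = ∑ i, ∑ j, a i * a j * A i j := by
  simp only [dotProduct, mulVec, Finset.mul_sum, star_trivial]
  exact Finset.sum_congr rfl fun i _ => Finset.sum_congr rfl fun j _ => by ring

section IntegralKernel

variable {n : ℕ} {A : Matrix (Fin n) (Fin n) ℝ} {k : Fin n → Fin n → ℝ → ℝ} {C : ℝ}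

lemma setIntegral_sum_sum_mul_eq (hi : ∀ i j, IntegrableOn (k i j) (Ioi 0))
    (hA : ∀ i j, ∫ u in Ioi (0 : ℝ), k i j u = C * A i j) (a : Fin n → ℝ) :
    IntegrableOn (fun u => ∑ i, ∑ j, a i * a j * k i j u) (Ioi 0) ∧
      ∫ u in Ioi (0 : ℝ), ∑ i, ∑ j, a i * a j * k i j u = C * ∑ i, ∑ j, a i * a j * A i j := by
  have hij : ∀ i j, IntegrableOn (fun u => a i * a j * k i j u) (Ioi 0) := fun i j =>
    (hi i j).const_mul _
  refine ⟨integrable_finsetSum _ fun i _ => integrable_finsetSum _ fun j _ => hij i j, ?_⟩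
  rw [integral_finsetSum _ fun i _ => integrable_finsetSum _ fun j _ => hij i j, Finset.mul_sum]
  refine Finset.sum_congr rfl fun i _ => ?_
  rw [integral_finsetSum _ fun j _ => hij i j, Finset.mul_sum]
  refine Finset.sum_congr rfl fun j _ => ?_
  rw [integral_const_mul, hA]
  ring

lemma Matrix.PosSemidef.of_setIntegral (hC : 0 < C) (hsymm : ∀ i j, A i j = A j i)
    (hi : ∀ i j, IntegrableOn (k i j) (Ioi 0))
    (hA : ∀ i j, ∫ u in Ioi (0 : ℝ), k i j u = C * A i j)
    (hnn : ∀ (a : Fin n → ℝ) (u : ℝ), 0 < u → 0 ≤ ∑ i, ∑ j, a i * a j * k i j u) :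
    A.PosSemidef := by
  refine .of_dotProduct_mulVec_nonneg (Matrix.IsHermitian.ext fun i j => hsymm j i) fun a => ?_
  rw [star_dotProduct_mulVec_eq_sum]
  refine nonneg_of_mul_nonneg_right (a := C) ?_ hC
  rw [← (setIntegral_sum_sum_mul_eq hi hA a).2]
  exact setIntegral_nonneg measurableSet_Ioi fun u hu => hnn a u hu

lemma Matrix.PosDef.of_setIntegral (hC : 0 < C) (hsymm : ∀ i j, A i j = A j i)
    (hc : ∀ i j, ContinuousOn (k i j) (Ioi 0))
    (hi : ∀ i j, IntegrableOn (k i j) (Ioi 0))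
    (hA : ∀ i j, ∫ u in Ioi (0 : ℝ), k i j u = C * A i j)
    (hnn : ∀ (a : Fin n → ℝ) (u : ℝ), 0 < u → 0 ≤ ∑ i, ∑ j, a i * a j * k i j u)
    (hpos : ∀ a : Fin n → ℝ, a ≠ 0 → ∃ u : ℝ, 0 < u ∧ 0 < ∑ i, ∑ j, a i * a j * k i j u) :
    A.PosDef := by
  refine .of_dotProduct_mulVec_pos (Matrix.IsHermitian.ext fun i j => hsymm j i) fun a ha => ?_
  rw [star_dotProduct_mulVec_eq_sum]
  refine pos_of_mul_pos_right (a := C) ?_ hC.le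
  obtain ⟨hint, heq⟩ := setIntegral_sum_sum_mul_eq hi hA a
  obtain ⟨v, hv, hfv⟩ := hpos a ha
  rw [← heq]
  refine setIntegral_Ioi_pos_of_continuousOn ?_ hint (hnn a) hv hfv
  exact continuousOn_finsetSum _ fun i _ => continuousOn_finsetSum _ fun j _ =>
    continuousOn_const.mul (hc i j)

end IntegralKernel

/-- The functions `u ↦ sin (t i * u)` with distinct positive frequencies are linearly independent
on `(0, ∞)`. -/
lemma eq_zero_of_sum_mul_sin_eq_zero {n : ℕ} {t : Fin n → ℝ} (hpos : ∀ i, 0 < t i)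
    (hinj : Function.Injective t) {a : Fin n → ℝ}
    (h : ∀ u, 0 < u → ∑ i, a i * sin (t i * u) = 0) : a = 0 := by
  have hsin : ∀ m : ℕ, ∀ u, 0 < u → ∑ i, a i * (t i ^ 2) ^ m * sin (t i * u) = 0 := by
    intro m
    induction m with
    | zero => simpa using h
    | succ m ih =>
      have hderiv : ∀ (f g : ℝ → ℝ), (∀ u, HasDerivAt f (g u) u) → (∀ u, 0 < u → f u = 0) →
          ∀ u, 0 < u → g u = 0 := by
        intro f g hfg hf u hu
        have hev : f =ᶠ[𝓝 u] fun _ => (0 : ℝ) := by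
          filter_upwards [Ioi_mem_nhds hu] with v hv using hf v hv
        exact (hfg u).unique ((hasDerivAt_const u (0 : ℝ)).congr_of_eventuallyEq hev)
      have hlin : ∀ (i : Fin n) (u : ℝ), HasDerivAt (fun u => t i * u) (t i) u := fun i u => by
        simpa using (hasDerivAt_id u).const_mul (t i)
      have h1 := hderiv _ (fun u => ∑ i, a i * (t i ^ 2) ^ m * (cos (t i * u) * t i))
        (fun u => HasDerivAt.fun_sum fun i _ => ((hlin i u).sin).const_mul _) ih
      have h2 := hderiv _
        (fun u => ∑ i, a i * (t i ^ 2) ^ m * (-sin (t i * u) * t i * t i))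
        (fun u => HasDerivAt.fun_sum fun i _ => (((hlin i u).cos).mul_const _).const_mul _) h1
      intro u hu
      rw [← neg_eq_zero, ← h2 u hu, ← Finset.sum_neg_distrib]
      exact Finset.sum_congr rfl fun i _ => by ring
  have hinj2 : Function.Injective fun i => t i ^ 2 := fun i j hij =>
    hinj ((pow_left_inj₀ (hpos i).le (hpos j).le two_ne_zero).1 hij)
  funext i
  have hu : 0 < π / 2 / t i := div_pos (by positivity) (hpos i)
  have hv := Matrix.eq_zero_of_forall_pow_sum_mul_pow_eq_zero (f := fun i => t i ^ 2)
    (v := fun j => a j * sin (t j * (π / 2 / t i))) hinj2 (fun m => by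
      rw [← hsin m _ hu]
      exact Finset.sum_congr rfl fun j _ => by ring)
  have := congrFun hv i
  simpa [mul_div_cancel₀ _ (hpos i).ne'] using this

/-- The covariance matrix of fractional Brownian motion with Hurst parameter `α / 2` at distinct
positive times is positive definite. -/
lemma fbm_covariance_matrix_posDef {α : ℝ} (h0 : 0 < α) (h2 : α < 2) {n : ℕ} {t : Fin n → ℝ}
    (hpos : ∀ i, 0 < t i) (hinj : Function.Injective t) :
    (Matrix.of fun i j : Fin n => t i ^ α + t j ^ α - |t i - t j| ^ α).PosDef := by
  obtain ⟨C, hC, hint⟩ := exists_integral_one_sub_cos_eq_mul_rpow h0 h2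
  have hsq : ∀ (a : Fin n → ℝ) (u : ℝ), ∑ i, ∑ j, a i * a j *
      ((1 - cos (t i * u)) * u ^ (-1 - α) + (1 - cos (t j * u)) * u ^ (-1 - α) -
        (1 - cos (|t i - t j| * u)) * u ^ (-1 - α)) =
      ((∑ i, a i * (1 - cos (t i * u))) ^ 2 + (∑ i, a i * sin (t i * u)) ^ 2) *
        u ^ (-1 - α) := by
    intro a u
    rw [sq, sq, Finset.sum_mul_sum, Finset.sum_mul_sum, ← Finset.sum_add_distrib, Finset.sum_mul]
    refine Finset.sum_congr rfl fun i _ => ?_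
    rw [← Finset.sum_add_distrib, Finset.sum_mul]
    refine Finset.sum_congr rfl fun j _ => ?_
    have hcos : cos (|t i - t j| * u) =
        cos (t i * u) * cos (t j * u) + sin (t i * u) * sin (t j * u) := by
      rw [← cos_sub, ← sub_mul]
      rcases abs_choice (t i - t j) with h | h <;> rw [h]
      rw [neg_mul, cos_neg]
    rw [hcos]
    ring
  refine Matrix.PosDef.of_setIntegral (k := fun i j u =>
    (1 - cos (t i * u)) * u ^ (-1 - α) + (1 - cos (t j * u)) * u ^ (-1 - α) -
      (1 - cos (|t i - t j| * u)) * u ^ (-1 - α)) hC ?_ ?_ ?_ ?_ ?_ ?_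
  · intro i j
    simp only [of_apply, abs_sub_comm (t i), add_comm (t i ^ α)]
  · intro i j
    have hpow : ContinuousOn (fun u : ℝ => u ^ (-1 - α)) (Ioi 0) := fun u hu =>
      (continuousAt_rpow_const u _ (Or.inl (ne_of_gt hu))).continuousWithinAt
    fun_prop
  · intro i j
    exact ((hint _ (hpos i).le).1.add (hint _ (hpos j).le).1).sub (hint _ (abs_nonneg _)).1
  · intro i j
    obtain ⟨hi, hi'⟩ := hint _ (hpos i).le
    obtain ⟨hj, hj'⟩ := hint _ (hpos j).le
    obtain ⟨hd, hd'⟩ := hint _ (abs_nonneg (t i - t j))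
    have hsub := integral_sub (hi.add hj) hd
    simp only [Pi.add_apply] at hsub
    rw [hsub, integral_add hi hj, hi', hj', hd', of_apply]
    ring
  · intro a u hu
    rw [hsq]
    have := rpow_pos_of_pos hu (-1 - α)
    positivity
  · intro a ha
    obtain ⟨u, hu, hne⟩ : ∃ u : ℝ, 0 < u ∧ ∑ i, a i * sin (t i * u) ≠ 0 := by
      by_contra! hcon
      exact ha (eq_zero_of_sum_mul_sin_eq_zero hpos hinj hcon)
    refine ⟨u, hu, ?_⟩
    rw [hsq]
    have := rpow_pos_of_pos hu (-1 - α)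
    positivity

/-- The entrywise exponential of a positive semidefinite matrix dominates its first order Taylor
polynomial in the Loewner order. -/
lemma Matrix.PosSemidef.sum_mul_le_sum_mul_exp_sub_one {n : ℕ} {M : Matrix (Fin n) (Fin n) ℝ}
    (hM : M.PosSemidef) (a : Fin n → ℝ) :
    ∑ i, ∑ j, a i * a j * M i j ≤ ∑ i, ∑ j, a i * a j * (exp (M i j) - 1) := by
  have hpow : ∀ m : ℕ, (Matrix.of fun i j => M i j ^ (m + 1)).PosSemidef := by
    intro m
    induction m with
    | zero => convert hM using 1; ext i j; simp
    | succ m ih =>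
      have heq : (Matrix.of fun i j => M i j ^ (m + 1 + 1)) =
          (Matrix.of fun i j => M i j ^ (m + 1)) ⊙ M := by
        ext i j
        exact pow_succ _ _
      rw [heq]
      exact ih.hadamard hM
  have hexp : ∀ x : ℝ, HasSum (fun m : ℕ => x ^ (m + 1) / (m + 1).factorial) (exp x - 1) := by
    intro x
    have := NormedSpace.expSeries_div_hasSum_exp (𝔸 := ℝ) x
    rw [← congrFun Real.exp_eq_exp_ℝ x] at this
    simpa using (hasSum_nat_add_iff' 1).2 this
  have hsum : HasSum (fun m : ℕ => ∑ i, ∑ j, a i * a j * (M i j ^ (m + 1) / (m + 1).factorial))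
      (∑ i, ∑ j, a i * a j * (exp (M i j) - 1)) :=
    hasSum_sum fun i _ => hasSum_sum fun j _ => (hexp (M i j)).mul_left _
  have hle := le_hasSum hsum 0 fun m _ => by
    have := (hpow m).dotProduct_mulVec_nonneg a
    rw [star_dotProduct_mulVec_eq_sum] at this
    simp only [mul_div_assoc', ← Finset.sum_div]
    positivity
  simpa using hle

/-- For `0 < K < 1`, `(x + y) ^ K - d ^ K` is a positive definite kernel as soon as `x + y - d`
is one. -/
lemma posDef_add_rpow_sub_rpow {K : ℝ} (h0 : 0 < K) (h1 : K < 1) {n : ℕ} {x : Fin n → ℝ}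
    {d : Fin n → Fin n → ℝ} (hx : ∀ i, 0 ≤ x i) (hd : ∀ i j, 0 ≤ d i j)
    (hM : (Matrix.of fun i j => x i + x j - d i j).PosDef) :
    (Matrix.of fun i j => (x i + x j) ^ K - d i j ^ K).PosDef := by
  obtain ⟨C, hC, hint⟩ := exists_integral_one_sub_exp_eq_mul_rpow h0 h1
  have hkey : ∀ (a : Fin n → ℝ) (u : ℝ), 0 < u →
      u * (∑ i, ∑ j, (a i * exp (-(x i * u))) * (a j * exp (-(x j * u))) *
        (x i + x j - d i j)) * u ^ (-1 - K) ≤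
      ∑ i, ∑ j, a i * a j * ((1 - exp (-((x i + x j) * u))) * u ^ (-1 - K) -
        (1 - exp (-(d i j * u))) * u ^ (-1 - K)) := by
    intro a u hu
    have h := (hM.posSemidef.smul hu.le).sum_mul_le_sum_mul_exp_sub_one
      fun i => a i * exp (-(x i * u))
    have h' := mul_le_mul_of_nonneg_right h (rpow_nonneg hu.le (-1 - K))
    refine (le_of_eq ?_).trans (h'.trans (le_of_eq ?_))
    · congr 1
      simp only [Finset.mul_sum, Matrix.smul_apply, of_apply, smul_eq_mul]
      exact Finset.sum_congr rfl fun i _ => Finset.sum_congr rfl fun j _ => by ring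
    · simp only [Finset.sum_mul, Matrix.smul_apply, of_apply, smul_eq_mul]
      refine Finset.sum_congr rfl fun i _ => Finset.sum_congr rfl fun j _ => ?_
      have hd' : exp (-(d i j * u)) =
          exp (-(x i * u)) * exp (-(x j * u)) * exp (u * (x i + x j - d i j)) := by
        rw [← exp_add, ← exp_add]; ring_nf
      have hx' : exp (-((x i + x j) * u)) = exp (-(x i * u)) * exp (-(x j * u)) := by
        rw [← exp_add]; ring_nf
      rw [hd', hx']
      ring
  refine Matrix.PosDef.of_setIntegral (k := fun i j u =>
    (1 - exp (-((x i + x j) * u))) * u ^ (-1 - K) -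
      (1 - exp (-(d i j * u))) * u ^ (-1 - K)) hC ?_ ?_ ?_ ?_ ?_ ?_
  · intro i j
    have := hM.isHermitian.apply i j
    simp only [of_apply, star_trivial] at this
    have hdd : d i j = d j i := by linarith
    simp only [of_apply, hdd, add_comm (x i)]
  · intro i j
    have hpow : ContinuousOn (fun u : ℝ => u ^ (-1 - K)) (Ioi 0) := fun u hu =>
      (continuousAt_rpow_const u _ (Or.inl (ne_of_gt hu))).continuousWithinAt
    fun_prop
  · intro i j
    exact (hint _ (add_nonneg (hx i) (hx j))).1.sub (hint _ (hd i j)).1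
  · intro i j
    obtain ⟨hi, hi'⟩ := hint _ (add_nonneg (hx i) (hx j))
    obtain ⟨hj, hj'⟩ := hint _ (hd i j)
    rw [integral_sub hi hj, hi', hj', of_apply]
    ring
  · intro a u hu
    refine le_trans ?_ (hkey a u hu)
    have hnn := hM.posSemidef.dotProduct_mulVec_nonneg fun i => a i * exp (-(x i * u))
    rw [star_dotProduct_mulVec_eq_sum] at hnn
    exact mul_nonneg (mul_nonneg hu.le hnn) (rpow_nonneg hu.le _)
  · intro a ha
    refine ⟨1, one_pos, lt_of_lt_of_le ?_ (hkey a 1 one_pos)⟩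
    have hb : (fun i => a i * exp (-(x i * 1))) ≠ 0 := by
      intro hb
      refine ha (funext fun i => ?_)
      simpa using congrFun hb i
    have hpos := hM.dotProduct_mulVec_pos hb
    rw [star_dotProduct_mulVec_eq_sum] at hpos
    exact mul_pos (mul_pos one_pos hpos) (rpow_pos_of_pos one_pos _)

/-- For `1 < K < 2`, `(x + y) ^ K - x ^ K - y ^ K` is a positive semidefinite kernel. -/
lemma posSemidef_add_rpow_sub_rpow_sub_rpow {K : ℝ} (h1 : 1 < K) (h2 : K < 2) {n : ℕ}
    {x : Fin n → ℝ} (hx : ∀ i, 0 ≤ x i) :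
    (Matrix.of fun i j => (x i + x j) ^ K - x i ^ K - x j ^ K).PosSemidef := by
  obtain ⟨C, hC, hint⟩ := exists_integral_exp_sub_one_add_eq_mul_rpow h1 h2
  refine Matrix.PosSemidef.of_setIntegral (k := fun i j u =>
    (exp (-((x i + x j) * u)) - 1 + (x i + x j) * u) * u ^ (-1 - K) -
      (exp (-(x i * u)) - 1 + x i * u) * u ^ (-1 - K) -
      (exp (-(x j * u)) - 1 + x j * u) * u ^ (-1 - K)) hC ?_ ?_ ?_ ?_
  · intro i j
    simp only [of_apply, add_comm (x i)]
    ring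
  · intro i j
    exact ((hint _ (add_nonneg (hx i) (hx j))).1.sub (hint _ (hx i)).1).sub (hint _ (hx j)).1
  · intro i j
    obtain ⟨hs, hs'⟩ := hint _ (add_nonneg (hx i) (hx j))
    obtain ⟨hi, hi'⟩ := hint _ (hx i)
    obtain ⟨hj, hj'⟩ := hint _ (hx j)
    have hsub := integral_sub (hs.sub hi) hj
    simp only [Pi.sub_apply] at hsub
    rw [hsub, integral_sub hs hi, hs', hi', hj', of_apply]
    ring
  · intro a u hu
    have hsq : ∑ i, ∑ j, a i * a j *
        ((exp (-((x i + x j) * u)) - 1 + (x i + x j) * u) * u ^ (-1 - K) -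
          (exp (-(x i * u)) - 1 + x i * u) * u ^ (-1 - K) -
          (exp (-(x j * u)) - 1 + x j * u) * u ^ (-1 - K)) =
        (∑ i, a i * (1 - exp (-(x i * u)))) ^ 2 * u ^ (-1 - K) := by
      rw [sq, Finset.sum_mul_sum, Finset.sum_mul]
      refine Finset.sum_congr rfl fun i _ => ?_
      rw [Finset.sum_mul]
      refine Finset.sum_congr rfl fun j _ => ?_
      have hx' : exp (-((x i + x j) * u)) = exp (-(x i * u)) * exp (-(x j * u)) := by
        rw [← exp_add]; ring_nf
      rw [hx']
      ring
    rw [hsq]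
    have := rpow_pos_of_pos hu (-1 - K)
    positivity

theorem bifbm_covariance_matrix_posDef (H K : ℝ) (hH0 : 0 < H) (hH1 : H < 1)
    (hK : (0 < K ∧ K < 1) ∨ (1 < K ∧ K < 2)) (hHK0 : 0 < H * K) (hHK1 : H * K < 1)
    (n : ℕ) (hn : 1 ≤ n) (t : Fin n → ℝ)
    (hpos : ∀ i, 0 < t i) (hmono : StrictMono t) :
    (Matrix.of fun i j : Fin n =>
      (2 : ℝ) ^ (-K) * (((t i) ^ (2 * H) + (t j) ^ (2 * H)) ^ K
        - |t i - t j| ^ (2 * H * K))).PosDef := by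
  suffices h : (Matrix.of fun i j : Fin n => ((t i) ^ (2 * H) + (t j) ^ (2 * H)) ^ K
      - |t i - t j| ^ (2 * H * K)).PosDef from
    h.smul (rpow_pos_of_pos two_pos (-K))
  have hx : ∀ i, 0 ≤ t i ^ (2 * H) := fun i => rpow_nonneg (hpos i).le _
  rcases hK with ⟨hK0, hK1⟩ | ⟨hK1, hK2⟩
  · simp only [rpow_mul (abs_nonneg _) (2 * H) K]
    exact posDef_add_rpow_sub_rpow hK0 hK1 hx (fun i j => rpow_nonneg (abs_nonneg _) _)
      (fbm_covariance_matrix_posDef (by linarith) (by linarith) hpos hmono.injective)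
  · have h := (fbm_covariance_matrix_posDef (α := 2 * H * K) (by linarith) (by linarith) hpos
      hmono.injective).add_posSemidef (posSemidef_add_rpow_sub_rpow_sub_rpow hK1 hK2 hx)
    convert h using 1
    ext i j
    simp only [of_apply, Matrix.add_apply, rpow_mul (hpos _).le (2 * H) K]
    ring
end
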